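/- arXiv:1612.08586 — 6 statements merged into one kernel-verified Lean document; each statement's English description precedes it below -/
import Mathlib

section
/- Let β > 1, let n be a positive integer, and let y₁,…,yₙ be real numbers. Then n · ∫_{-∞}^{∞} ( (1/n)∑_{j=1}^n exp(t·yⱼ) − exp(t²/2) )² · exp(−β t²) dt = √π · ( n/√(β−1) − (2/√(β−1/2)) · ∑_{i=1}^n exp( yᵢ²/(4β−2) ) + (1/(n√β)) · ∑_{i=1}^n ∑_{j=1}^n exp( (yᵢ+yⱼ)²/(4β) ) ). -/
open MeasureTheory Real

theorem exp_linear_sub_quadratic_eq {b : ℝ} (hb : 0 < b) (c t : ℝ) :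
    Real.exp (c * t - b * t ^ 2)
      = Real.exp (c ^ 2 / (4 * b)) * Real.exp (-b * (t - c / (2 * b)) ^ 2) := by
  rw [← Real.exp_add]
  congr 1
  field_simp
  ring

theorem integrable_exp_linear_sub_quadratic {b : ℝ} (hb : 0 < b) (c : ℝ) :
    Integrable fun t : ℝ => Real.exp (c * t - b * t ^ 2) := by
  simp_rw [exp_linear_sub_quadratic_eq hb]
  exact ((integrable_exp_neg_mul_sq hb).comp_sub_right (c / (2 * b))).const_mul _

theorem integral_exp_linear_sub_quadratic {b : ℝ} (hb : 0 < b) (c : ℝ) :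
    ∫ t : ℝ, Real.exp (c * t - b * t ^ 2)
      = Real.sqrt π / Real.sqrt b * Real.exp (c ^ 2 / (4 * b)) := by
  simp_rw [exp_linear_sub_quadratic_eq hb]
  rw [integral_const_mul,
    integral_sub_right_eq_self (fun t : ℝ => Real.exp (-b * t ^ 2)) (c / (2 * b)),
    integral_gaussian, Real.sqrt_div Real.pi_pos.le, mul_comm]

/-- Expansion of the weighted squared difference between a mean of exponentials and
`exp (t ^ 2 / 2)` into exponentials of quadratic polynomials. -/
theorem weighted_sq_sub_eq_sum_exp (β : ℝ) (n : ℕ) (y : Fin n → ℝ) (t : ℝ) :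
    ((1 / n : ℝ) * ∑ j, Real.exp (t * y j) - Real.exp (t ^ 2 / 2)) ^ 2
        * Real.exp (-β * t ^ 2)
      = Real.exp (0 * t - (β - 1) * t ^ 2)
        - 2 / n * ∑ i, Real.exp (y i * t - (β - 1 / 2) * t ^ 2)
        + 1 / (n : ℝ) ^ 2 * ∑ i, ∑ j, Real.exp ((y i + y j) * t - β * t ^ 2) := by
  have hconst : Real.exp (0 * t - (β - 1) * t ^ 2)
      = Real.exp (t ^ 2 / 2) ^ 2 * Real.exp (-β * t ^ 2) := by
    rw [sq (Real.exp _), ← Real.exp_add, ← Real.exp_add]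
    congr 1
    ring
  have hcross (i : Fin n) : Real.exp (y i * t - (β - 1 / 2) * t ^ 2)
      = Real.exp (t * y i) * (Real.exp (t ^ 2 / 2) * Real.exp (-β * t ^ 2)) := by
    rw [← Real.exp_add, ← Real.exp_add]
    congr 1
    ring
  have hpair (i j : Fin n) : Real.exp ((y i + y j) * t - β * t ^ 2)
      = Real.exp (t * y i) * Real.exp (t * y j) * Real.exp (-β * t ^ 2) := by
    rw [← Real.exp_add, ← Real.exp_add]
    congr 1
    ring
  simp_rw [hconst, hcross, hpair, ← Finset.sum_mul, ← Finset.mul_sum, ← Finset.sum_mul]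
  ring

/-- Closed-form sum representation of the weighted L²-statistic
`T_{n,β} = n ∫ (Mₙ(t) − M₀(t))² exp(−βt²) dt`. -/
theorem sum_representation_of_Tnbeta (β : ℝ) (hβ : 1 < β) (n : ℕ) (hn : 0 < n)
    (y : Fin n → ℝ) :
    (n : ℝ) * ∫ t : ℝ,
        ((1 / n : ℝ) * ∑ j, Real.exp (t * y j) - Real.exp (t ^ 2 / 2)) ^ 2
          * Real.exp (-β * t ^ 2)
      = Real.sqrt π *
          ((n : ℝ) / Real.sqrt (β - 1)
            - 2 / Real.sqrt (β - 1 / 2) * ∑ i, Real.exp ((y i) ^ 2 / (4 * β - 2))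
            + 1 / (n * Real.sqrt β) * ∑ i, ∑ j, Real.exp ((y i + y j) ^ 2 / (4 * β))) := by
  have hβ₁ : 0 < β - 1 := by linarith
  have hβ₂ : 0 < β - 1 / 2 := by linarith
  have hβ₀ : 0 < β := by linarith
  have hn' : (n : ℝ) ≠ 0 := by positivity
  have hconst := integrable_exp_linear_sub_quadratic hβ₁ 0
  have hcross (i : Fin n) := integrable_exp_linear_sub_quadratic hβ₂ (y i)
  have hpair (i j : Fin n) := integrable_exp_linear_sub_quadratic hβ₀ (y i + y j)
  have hcross_sum := (integrable_finsetSum Finset.univ fun i _ => hcross i).const_mul (2 / (n : ℝ))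
  have hpair_row (i : Fin n) := integrable_finsetSum Finset.univ fun j _ => hpair i j
  have hpair_sum := (integrable_finsetSum Finset.univ fun i _ => hpair_row i).const_mul
    (1 / (n : ℝ) ^ 2)
  simp_rw [weighted_sq_sub_eq_sum_exp]
  rw [integral_add (by exact hconst.sub hcross_sum) hpair_sum, integral_sub hconst hcross_sum,
    integral_const_mul, integral_const_mul, integral_finsetSum _ fun i _ => hcross i,
    integral_finsetSum _ fun i _ => hpair_row i]
  simp_rw [integral_finsetSum _ fun j _ => hpair _ j, integral_exp_linear_sub_quadratic hβ₁,
    integral_exp_linear_sub_quadratic hβ₂, integral_exp_linear_sub_quadratic hβ₀,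
    ← Finset.mul_sum, show 4 * (β - 1 / 2) = 4 * β - 2 by ring]
  simp only [ne_eq, OfNat.ofNat_ne_zero, not_false_eq_true, zero_pow, zero_div, Real.exp_zero]
  field_simp
end

section
/- Let X be a standard normal random variable and define h(x,t) = exp(t·x) − exp(t²/2) − (x²−1)·(t²·exp(t²/2))/2 − x·t·exp(t²/2). Then for all s, t ∈ ℝ, E[h(X,s)·h(X,t)] = exp((s²+t²)/2) · ( exp(s·t) − 1 − s·t − s²t²/2 ); equivalently, ∫_{-∞}^{∞} h(x,s)h(x,t) · (2π)^{-1/2} exp(−x²/2) dx = K(s,t) with K(s,t) = e^{(s²+t²)/2}( e^{st} − 1 − st − s²t²/2 ). -/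
open MeasureTheory Real

open ProbabilityTheory

lemma integrable_pow_mul_exp_gaussianReal (n : ℕ) (u : ℝ) :
    Integrable (fun x : ℝ ↦ x ^ n * exp (u * x)) (gaussianReal 0 1) :=
  integrable_pow_mul_exp_of_mem_interior_integrableExpSet (X := id)
    (by simp [integrableExpSet_id_gaussianReal]) n

/-- Differentiating under the integral sign raises the exponent of the monomial by one. -/
lemma integral_pow_succ_mul_exp_gaussianReal {n : ℕ} {p : ℝ → ℝ} {p' : ℝ} {u : ℝ}
    (h : ∀ v, ∫ x, x ^ n * exp (v * x) ∂(gaussianReal 0 1) = p v * exp (v ^ 2 / 2))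
    (hp : HasDerivAt p p' u) :
    ∫ x, x ^ (n + 1) * exp (u * x) ∂(gaussianReal 0 1) = (p' + u * p u) * exp (u ^ 2 / 2) := by
  have hd := hasDerivAt_integral_pow_mul_exp_real (X := id) (μ := gaussianReal 0 1) (t := u)
    (by simp [integrableExpSet_id_gaussianReal]) n
  simp only [id_eq, h] at hd
  have hq : HasDerivAt (fun v : ℝ ↦ v ^ 2 / 2) u u := by
    simpa using (hasDerivAt_pow 2 u).div_const 2
  rw [hd.unique (hp.mul hq.exp)]
  ring

lemma integral_exp_gaussianReal (u : ℝ) :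
    ∫ x, x ^ 0 * exp (u * x) ∂(gaussianReal 0 1) = 1 * exp (u ^ 2 / 2) := by
  simpa [mgf] using congrFun (mgf_id_gaussianReal (μ := 0) (v := 1)) u

lemma integral_id_mul_exp_gaussianReal (u : ℝ) :
    ∫ x, x ^ 1 * exp (u * x) ∂(gaussianReal 0 1) = u * exp (u ^ 2 / 2) := by
  rw [integral_pow_succ_mul_exp_gaussianReal integral_exp_gaussianReal (hasDerivAt_const u 1)]
  ring

lemma integral_sq_mul_exp_gaussianReal (u : ℝ) :
    ∫ x, x ^ 2 * exp (u * x) ∂(gaussianReal 0 1) = (u ^ 2 + 1) * exp (u ^ 2 / 2) := by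
  rw [integral_pow_succ_mul_exp_gaussianReal integral_id_mul_exp_gaussianReal (hasDerivAt_id' u)]
  ring

lemma integral_cube_mul_exp_gaussianReal (u : ℝ) :
    ∫ x, x ^ 3 * exp (u * x) ∂(gaussianReal 0 1) = (u ^ 3 + 3 * u) * exp (u ^ 2 / 2) := by
  rw [integral_pow_succ_mul_exp_gaussianReal integral_sq_mul_exp_gaussianReal
    ((hasDerivAt_pow 2 u).add_const 1)]
  push_cast
  ring

lemma integral_pow_four_mul_exp_gaussianReal (u : ℝ) :
    ∫ x, x ^ 4 * exp (u * x) ∂(gaussianReal 0 1) =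
      (u ^ 4 + 6 * u ^ 2 + 3) * exp (u ^ 2 / 2) := by
  rw [integral_pow_succ_mul_exp_gaussianReal integral_cube_mul_exp_gaussianReal
    ((hasDerivAt_pow 3 u).add ((hasDerivAt_id' u).const_mul 3))]
  push_cast
  ring

lemma integrable_quartic_mul_exp_gaussianReal (a b c d e u : ℝ) :
    Integrable (fun x : ℝ ↦ a * (x ^ 0 * exp (u * x)) + b * (x ^ 1 * exp (u * x))
      + c * (x ^ 2 * exp (u * x)) + d * (x ^ 3 * exp (u * x)) + e * (x ^ 4 * exp (u * x)))
      (gaussianReal 0 1) := by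
  have h (n : ℕ) (r : ℝ) := (integrable_pow_mul_exp_gaussianReal n u).const_mul r
  exact ((((h 0 a).add (h 1 b)).add (h 2 c)).add (h 3 d)).add (h 4 e)

lemma integral_quartic_mul_exp_gaussianReal (a b c d e u : ℝ) :
    ∫ x : ℝ, a * (x ^ 0 * exp (u * x)) + b * (x ^ 1 * exp (u * x))
      + c * (x ^ 2 * exp (u * x)) + d * (x ^ 3 * exp (u * x)) + e * (x ^ 4 * exp (u * x))
      ∂(gaussianReal 0 1) =
      (a + b * u + c * (u ^ 2 + 1) + d * (u ^ 3 + 3 * u) + e * (u ^ 4 + 6 * u ^ 2 + 3))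
        * exp (u ^ 2 / 2) := by
  have h (n : ℕ) (r : ℝ) := (integrable_pow_mul_exp_gaussianReal n u).const_mul r
  rw [integral_add ((((h 0 a).fun_add (h 1 b)).fun_add (h 2 c)).fun_add (h 3 d)) (h 4 e),
    integral_add (((h 0 a).fun_add (h 1 b)).fun_add (h 2 c)) (h 3 d),
    integral_add ((h 0 a).fun_add (h 1 b)) (h 2 c), integral_add (h 0 a) (h 1 b)]
  simp only [integral_const_mul, integral_exp_gaussianReal, integral_id_mul_exp_gaussianReal,
    integral_sq_mul_exp_gaussianReal, integral_cube_mul_exp_gaussianReal,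
    integral_pow_four_mul_exp_gaussianReal]
  ring

/-- For standard normal `X`, `E[h(X,s)h(X,t)] = K(s,t)` with
`K(s,t) = e^{(s²+t²)/2}(e^{st} − 1 − st − s²t²/2)`. -/
theorem integral_h_mul_h_eq_kernel (s t : ℝ) :
    ∫ x : ℝ,
        ((Real.exp (s * x) - Real.exp (s ^ 2 / 2)
            - (x ^ 2 - 1) * (s ^ 2 * Real.exp (s ^ 2 / 2)) / 2
            - x * (s * Real.exp (s ^ 2 / 2)))
          * (Real.exp (t * x) - Real.exp (t ^ 2 / 2)
            - (x ^ 2 - 1) * (t ^ 2 * Real.exp (t ^ 2 / 2)) / 2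
            - x * (t * Real.exp (t ^ 2 / 2))))
          * ((Real.sqrt (2 * π))⁻¹ * Real.exp (-x ^ 2 / 2))
      = Real.exp ((s ^ 2 + t ^ 2) / 2)
          * (Real.exp (s * t) - 1 - s * t - s ^ 2 * t ^ 2 / 2) := by
  set A := exp (s ^ 2 / 2) with hA
  set B := exp (t ^ 2 / 2) with hB
  let q (a b c d e u x : ℝ) : ℝ := a * (x ^ 0 * exp (u * x)) + b * (x ^ 1 * exp (u * x))
      + c * (x ^ 2 * exp (u * x)) + d * (x ^ 3 * exp (u * x)) + e * (x ^ 4 * exp (u * x))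
  have hq (a b c d e u : ℝ) : Integrable (q a b c d e u) (gaussianReal 0 1) :=
    integrable_quartic_mul_exp_gaussianReal a b c d e u
  have hI (a b c d e u : ℝ) : ∫ x, q a b c d e u x ∂(gaussianReal 0 1) = _ :=
    integral_quartic_mul_exp_gaussianReal a b c d e u
  have h₁ := hq 1 0 0 0 0 (s + t)
  have h₂ := hq (-A * (1 - s ^ 2 / 2)) (-A * s) (-A * s ^ 2 / 2) 0 0 t
  have h₃ := hq (-B * (1 - t ^ 2 / 2)) (-B * t) (-B * t ^ 2 / 2) 0 0 s
  have h₄ := hq (A * B * (1 - s ^ 2 / 2) * (1 - t ^ 2 / 2))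
    (A * B * (s * (1 - t ^ 2 / 2) + t * (1 - s ^ 2 / 2)))
    (A * B * (s * t + s ^ 2 / 2 * (1 - t ^ 2 / 2) + t ^ 2 / 2 * (1 - s ^ 2 / 2)))
    (A * B * (s * t ^ 2 / 2 + t * s ^ 2 / 2)) (A * B * (s ^ 2 * t ^ 2 / 4)) 0
  have hsum := integral_add ((h₁.fun_add h₂).fun_add h₃) h₄
  rw [integral_add (h₁.fun_add h₂) h₃, integral_add h₁ h₂, hI, hI, hI, hI,
    integral_gaussianReal_eq_integral_smul one_ne_zero] at hsum
  have hexp : exp ((s + t) ^ 2 / 2) = A * B * exp (s * t) := by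
    rw [hA, hB, ← exp_add, ← exp_add]
    ring_nf
  have hAB : exp ((s ^ 2 + t ^ 2) / 2) = A * B := by
    rw [hA, hB, ← exp_add]
    ring_nf
  have hzero : exp ((0 : ℝ) ^ 2 / 2) = 1 := by simp
  rw [hexp, ← hA, ← hB, hzero] at hsum
  rw [hAB]
  convert hsum using 1
  · refine integral_congr_ae (.of_forall fun x ↦ ?_)
    simp only [q, gaussianPDFReal, smul_eq_mul, NNReal.coe_one, mul_one, sub_zero, add_mul s t x,
      exp_add, zero_mul, exp_zero]
    ring
  · ring
end

section
/- Let β > 2, let K(s,t) = exp((s²+t²)/2) · ( exp(s·t) − 1 − s·t − s²t²/2 ), and set γ = 4(β−1)² − 1. Then 2 ∫_{-∞}^{∞} ∫_{-∞}^{∞} K(s,t)² · exp(−β s²) · exp(−β t²) ds dt = 2π · ( 1/(√β·√(β−2)) − 4/√γ − 6/γ^{3/2} − 6/γ^{5/2} + 1/(β−1) + 1/(2(β−1)³) + 9/(64(β−1)⁵) ). -/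
open MeasureTheory Real

theorem integral_sub_add_of_integrable {α : Type*} [MeasurableSpace α] {μ : Measure α}
    {f g h : α → ℝ} (hf : Integrable f μ) (hg : Integrable g μ) (hh : Integrable h μ) :
    ∫ x, (f x - g x + h x) ∂μ = ∫ x, f x ∂μ - ∫ x, g x ∂μ + ∫ x, h x ∂μ := by
  rw [← integral_sub hf hg]
  exact integral_add (hf.sub hg) hh

theorem integrable_pow_mul_exp_neg_mul_sq {a : ℝ} (ha : 0 < a) (n : ℕ) :
    Integrable fun x : ℝ => x ^ n * exp (-a * x ^ 2) := by
  have h := integrable_rpow_mul_exp_neg_mul_sq ha (s := n)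
    (by have : (0 : ℝ) ≤ n := n.cast_nonneg
        linarith)
  simpa only [rpow_natCast] using h

theorem hasDerivAt_exp_neg_mul_sq (a x : ℝ) :
    HasDerivAt (fun x : ℝ => exp (-a * x ^ 2)) (-2 * a * (x ^ 1 * exp (-a * x ^ 2))) x := by
  convert ((hasDerivAt_pow 2 x).const_mul (-a)).exp using 1
  push_cast
  ring

theorem integral_pow_one_mul_exp_neg_mul_sq {a : ℝ} (ha : 0 < a) :
    ∫ x : ℝ, x ^ 1 * exp (-a * x ^ 2) = 0 := by
  have h := integral_eq_zero_of_hasDerivAt_of_integrable (hasDerivAt_exp_neg_mul_sq a)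
    ((integrable_pow_mul_exp_neg_mul_sq ha 1).const_mul _) (integrable_exp_neg_mul_sq ha)
  rw [integral_const_mul] at h
  exact (mul_eq_zero.mp h).resolve_left (by linarith)

theorem integral_pow_add_two_mul_exp_neg_mul_sq {a : ℝ} (ha : 0 < a) (n : ℕ) :
    ∫ x : ℝ, x ^ (n + 2) * exp (-a * x ^ 2)
      = (n + 1) / (2 * a) * ∫ x : ℝ, x ^ n * exp (-a * x ^ 2) := by
  have hd (x : ℝ) : HasDerivAt (fun x : ℝ => x ^ (n + 1) * exp (-a * x ^ 2))
      ((n + 1) * (x ^ n * exp (-a * x ^ 2)) - 2 * a * (x ^ (n + 2) * exp (-a * x ^ 2))) x := by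
    refine ((hasDerivAt_pow (n + 1) x).fun_mul (hasDerivAt_exp_neg_mul_sq a x)).congr_deriv ?_
    rw [Nat.add_sub_cancel]
    push_cast
    ring
  have h₀ := (integrable_pow_mul_exp_neg_mul_sq ha n).const_mul (n + 1 : ℝ)
  have h₂ := (integrable_pow_mul_exp_neg_mul_sq ha (n + 2)).const_mul (2 * a)
  have h := integral_eq_zero_of_hasDerivAt_of_integrable hd (h₀.sub h₂)
    (integrable_pow_mul_exp_neg_mul_sq ha (n + 1))
  rw [integral_sub h₀ h₂, integral_const_mul, integral_const_mul] at h
  rw [div_mul_eq_mul_div, eq_div_iff (by positivity)]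
  linarith

theorem integrable_quartic_mul_exp_neg_mul_sq {a : ℝ} (ha : 0 < a) (p q r u v : ℝ) :
    Integrable fun x : ℝ =>
      (p + q * x + r * x ^ 2 + u * x ^ 3 + v * x ^ 4) * exp (-a * x ^ 2) := by
  have h := integrable_pow_mul_exp_neg_mul_sq ha
  refine ((((((h 0).const_mul p).add ((h 1).const_mul q)).add ((h 2).const_mul r)).add
    ((h 3).const_mul u)).add ((h 4).const_mul v)).congr (.of_forall fun x => ?_)
  simp only [Pi.add_apply]
  ring

theorem integral_quartic_mul_exp_neg_mul_sq {a : ℝ} (ha : 0 < a) (p q r u v : ℝ) :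
    ∫ x : ℝ, (p + q * x + r * x ^ 2 + u * x ^ 3 + v * x ^ 4) * exp (-a * x ^ 2)
      = √(π / a) * (p + r / (2 * a) + 3 * v / (4 * a ^ 2)) := by
  have h := integrable_pow_mul_exp_neg_mul_sq ha
  have e (x : ℝ) : (p + q * x + r * x ^ 2 + u * x ^ 3 + v * x ^ 4) * exp (-a * x ^ 2)
      = p * (x ^ 0 * exp (-a * x ^ 2)) + q * (x ^ 1 * exp (-a * x ^ 2))
        + r * (x ^ (0 + 2) * exp (-a * x ^ 2)) + u * (x ^ (1 + 2) * exp (-a * x ^ 2))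
        + v * (x ^ (0 + 2 + 2) * exp (-a * x ^ 2)) := by ring
  have h₀ := (h 0).const_mul p
  have h₁ := h₀.fun_add ((h 1).const_mul q)
  have h₂ := h₁.fun_add ((h (0 + 2)).const_mul r)
  have h₃ := h₂.fun_add ((h (1 + 2)).const_mul u)
  simp_rw [e]
  rw [integral_add h₃ ((h (0 + 2 + 2)).const_mul v), integral_add h₂ ((h (1 + 2)).const_mul u),
    integral_add h₁ ((h (0 + 2)).const_mul r), integral_add h₀ ((h 1).const_mul q)]
  simp only [integral_const_mul, integral_pow_add_two_mul_exp_neg_mul_sq ha,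
    integral_pow_one_mul_exp_neg_mul_sq ha]
  simp only [pow_zero, one_mul, integral_gaussian]
  push_cast
  field_simp
  ring

theorem quadratic_mul_exp_eq_comp_sub {a : ℝ} (ha : 0 < a) (b p q r x : ℝ) :
    (p + q * x + r * x ^ 2) * exp (-a * x ^ 2 + b * x)
      = exp (b ^ 2 / (4 * a)) *
        (((p + q * (b / (2 * a)) + r * (b / (2 * a)) ^ 2)
          + (q + 2 * r * (b / (2 * a))) * (x - b / (2 * a)) + r * (x - b / (2 * a)) ^ 2
          + 0 * (x - b / (2 * a)) ^ 3 + 0 * (x - b / (2 * a)) ^ 4)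
          * exp (-a * (x - b / (2 * a)) ^ 2)) := by
  have e : -a * x ^ 2 + b * x = b ^ 2 / (4 * a) + -a * (x - b / (2 * a)) ^ 2 := by
    field_simp
    ring
  rw [e, exp_add]
  ring

theorem integrable_quadratic_mul_exp {a : ℝ} (ha : 0 < a) (b p q r : ℝ) :
    Integrable fun x : ℝ => (p + q * x + r * x ^ 2) * exp (-a * x ^ 2 + b * x) := by
  simp_rw [quadratic_mul_exp_eq_comp_sub ha]
  exact ((integrable_quartic_mul_exp_neg_mul_sq ha _ _ _ _ _).comp_sub_right _).const_mul _

theorem integral_quadratic_mul_exp {a : ℝ} (ha : 0 < a) (b p q r : ℝ) :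
    ∫ x : ℝ, (p + q * x + r * x ^ 2) * exp (-a * x ^ 2 + b * x)
      = √(π / a) * exp (b ^ 2 / (4 * a))
        * (p + q * (b / (2 * a)) + r * ((b / (2 * a)) ^ 2 + 1 / (2 * a))) := by
  simp_rw [quadratic_mul_exp_eq_comp_sub ha]
  rw [integral_const_mul, integral_sub_right_eq_self (fun y : ℝ =>
    ((p + q * (b / (2 * a)) + r * (b / (2 * a)) ^ 2)
      + (q + 2 * r * (b / (2 * a))) * y + r * y ^ 2 + 0 * y ^ 3 + 0 * y ^ 4)
      * exp (-a * y ^ 2)), integral_quartic_mul_exp_neg_mul_sq ha]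
  ring

theorem kernel_sq_mul_exp_eq (β s t : ℝ) :
    (exp ((s ^ 2 + t ^ 2) / 2) * (exp (s * t) - 1 - s * t - s ^ 2 * t ^ 2 / 2)) ^ 2
        * exp (-β * s ^ 2) * exp (-β * t ^ 2)
      = exp (-(β - 1) * s ^ 2) *
        ((1 + 0 * t + 0 * t ^ 2) * exp (-(β - 1) * t ^ 2 + 2 * s * t)
          - (2 + 2 * s * t + s ^ 2 * t ^ 2) * exp (-(β - 1) * t ^ 2 + s * t)
          + (1 + 2 * s * t + 2 * s ^ 2 * t ^ 2 + s ^ 3 * t ^ 3 + s ^ 4 / 4 * t ^ 4)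
            * exp (-(β - 1) * t ^ 2)) := by
  have hs : exp (-(β - 1) * s ^ 2) = exp (s ^ 2 / 2) ^ 2 * exp (-β * s ^ 2) := by
    rw [← exp_nat_mul, ← exp_add]
    congr 1
    push_cast
    ring
  have ht : exp (-(β - 1) * t ^ 2) = exp (t ^ 2 / 2) ^ 2 * exp (-β * t ^ 2) := by
    rw [← exp_nat_mul, ← exp_add]
    congr 1
    push_cast
    ring
  have h₂ : exp (2 * s * t) = exp (s * t) ^ 2 := by
    rw [← exp_nat_mul]
    congr 1
    push_cast
    ring
  rw [exp_add (-(β - 1) * t ^ 2), exp_add (-(β - 1) * t ^ 2), hs, ht, h₂, add_div, exp_add]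
  ring

theorem integral_kernel_sq_mul_exp {a : ℝ} (ha : 0 < a) (s : ℝ) :
    ∫ t : ℝ, exp (-a * s ^ 2) *
        ((1 + 0 * t + 0 * t ^ 2) * exp (-a * t ^ 2 + 2 * s * t)
          - (2 + 2 * s * t + s ^ 2 * t ^ 2) * exp (-a * t ^ 2 + s * t)
          + (1 + 2 * s * t + 2 * s ^ 2 * t ^ 2 + s ^ 3 * t ^ 3 + s ^ 4 / 4 * t ^ 4)
            * exp (-a * t ^ 2))
      = √(π / a) *
        ((1 + 0 * s + 0 * s ^ 2 + 0 * s ^ 3 + 0 * s ^ 4) * exp (-(a - 1 / a) * s ^ 2)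
          - (2 + 0 * s + 3 / (2 * a) * s ^ 2 + 0 * s ^ 3 + 1 / (4 * a ^ 2) * s ^ 4)
            * exp (-(a - 1 / (4 * a)) * s ^ 2)
          + (1 + 0 * s + 1 / a * s ^ 2 + 0 * s ^ 3 + 3 / (16 * a ^ 2) * s ^ 4)
            * exp (-a * s ^ 2)) := by
  have h₂ := integrable_quadratic_mul_exp ha (2 * s) 1 0 0
  have h₁ := integrable_quadratic_mul_exp ha s 2 (2 * s) (s ^ 2)
  have h₀ := integrable_quartic_mul_exp_neg_mul_sq ha 1 (2 * s) (2 * s ^ 2) (s ^ 3) (s ^ 4 / 4)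
  have e₂ : exp (-(a - 1 / a) * s ^ 2) = exp (-a * s ^ 2) * exp ((2 * s) ^ 2 / (4 * a)) := by
    rw [← exp_add]
    congr 1
    field_simp
    ring
  have e₁ : exp (-(a - 1 / (4 * a)) * s ^ 2) = exp (-a * s ^ 2) * exp (s ^ 2 / (4 * a)) := by
    rw [← exp_add]
    congr 1
    field_simp
    ring
  rw [integral_const_mul, integral_sub_add_of_integrable h₂ h₁ h₀,
    integral_quadratic_mul_exp ha, integral_quadratic_mul_exp ha,
    integral_quartic_mul_exp_neg_mul_sq ha, e₁, e₂]
  field_simp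
  ring

theorem sqrt_pi_div_mul_sqrt_pi_div {x y : ℝ} (hx : 0 < x) :
    √(π / x) * √(π / y) = π / √(x * y) := by
  rw [← sqrt_mul (by positivity), div_mul_div_comm, sqrt_div (by positivity),
    sqrt_mul_self pi_pos.le]

/-- Variance of the limit statistic: `2∫∫ K(s,t)² e^{−βs²}e^{−βt²} ds dt` in closed form, `β > 2`,
where `K(s,t) = e^{(s²+t²)/2}(e^{st} − 1 − st − s²t²/2)` and `γ = 4(β−1)² − 1`. -/
theorem double_integral_kernel_sq (β : ℝ) (hβ : 2 < β) :
    2 * ∫ s : ℝ, ∫ t : ℝ,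
        (Real.exp ((s ^ 2 + t ^ 2) / 2)
            * (Real.exp (s * t) - 1 - s * t - s ^ 2 * t ^ 2 / 2)) ^ 2
          * Real.exp (-β * s ^ 2) * Real.exp (-β * t ^ 2)
      = 2 * π *
          (1 / (Real.sqrt β * Real.sqrt (β - 2))
            - 4 / Real.sqrt (4 * (β - 1) ^ 2 - 1)
            - 6 / (4 * (β - 1) ^ 2 - 1) ^ (3 / 2 : ℝ)
            - 6 / (4 * (β - 1) ^ 2 - 1) ^ (5 / 2 : ℝ)
            + 1 / (β - 1)
            + 1 / (2 * (β - 1) ^ 3)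
            + 9 / (64 * (β - 1) ^ 5)) := by
  have ha : 0 < β - 1 := by linarith
  have hγ : 0 < 4 * (β - 1) ^ 2 - 1 := by nlinarith
  simp_rw [kernel_sq_mul_exp_eq, integral_kernel_sq_mul_exp ha]
  have hβ' : √β * √(β - 2) = √((β - 1) * ((β - 1) - 1 / (β - 1))) := by
    rw [← sqrt_mul (by linarith)]
    congr 1
    field_simp
    ring
  have h32 : (4 * (β - 1) ^ 2 - 1) ^ (3 / 2 : ℝ)
      = (4 * (β - 1) ^ 2 - 1) * √(4 * (β - 1) ^ 2 - 1) := by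
    rw [show (3 / 2 : ℝ) = 1 + 1 / 2 by norm_num, rpow_add hγ, rpow_one, sqrt_eq_rpow]
  have h52 : (4 * (β - 1) ^ 2 - 1) ^ (5 / 2 : ℝ)
      = (4 * (β - 1) ^ 2 - 1) ^ 2 * √(4 * (β - 1) ^ 2 - 1) := by
    rw [show (5 / 2 : ℝ) = (2 : ℕ) + 1 / 2 by norm_num, rpow_add hγ, rpow_natCast, sqrt_eq_rpow]
  rw [h32, h52, hβ']
  have ha₁' : 1 < β - 1 := by linarith
  generalize β - 1 = a at *
  have ha₂ : 0 < a - 1 / a := by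
    have := (div_lt_one ha).mpr ha₁'
    linarith
  have ha₁ : 0 < a - 1 / (4 * a) := by
    rw [show a - 1 / (4 * a) = (4 * a ^ 2 - 1) / (4 * a) by field_simp]
    positivity
  have i₂ := integrable_quartic_mul_exp_neg_mul_sq ha₂ 1 0 0 0 0
  have i₁ := integrable_quartic_mul_exp_neg_mul_sq ha₁ 2 0 (3 / (2 * a)) 0 (1 / (4 * a ^ 2))
  have i₀ := integrable_quartic_mul_exp_neg_mul_sq ha 1 0 (1 / a) 0 (3 / (16 * a ^ 2))
  rw [integral_const_mul, integral_sub_add_of_integrable i₂ i₁ i₀,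
    integral_quartic_mul_exp_neg_mul_sq ha₂, integral_quartic_mul_exp_neg_mul_sq ha₁,
    integral_quartic_mul_exp_neg_mul_sq ha]
  have s₂ := sqrt_pi_div_mul_sqrt_pi_div (y := a - 1 / a) ha
  have s₁ : √(π / a) * √(π / (a - 1 / (4 * a))) = 2 * π / √(4 * a ^ 2 - 1) := by
    rw [sqrt_pi_div_mul_sqrt_pi_div ha,
      show a * (a - 1 / (4 * a)) = (4 * a ^ 2 - 1) / 2 ^ 2 by field_simp; ring,
      sqrt_div' _ (by positivity), sqrt_sq zero_le_two]
    field_simp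
  have s₀ : √(π / a) * √(π / a) = π / a := mul_self_sqrt (by positivity)
  have r₁ : a - 1 / (4 * a) = (4 * a ^ 2 - 1) / (4 * a) := by field_simp
  calc _ = 2 * ((√(π / a) * √(π / (a - 1 / a)))
        - (√(π / a) * √(π / (a - 1 / (4 * a)))) * (2 + 3 / (2 * a) / (2 * (a - 1 / (4 * a)))
          + 3 * (1 / (4 * a ^ 2)) / (4 * (a - 1 / (4 * a)) ^ 2))
        + (√(π / a) * √(π / a)) * (1 + 1 / a / (2 * a) + 3 * (3 / (16 * a ^ 2)) / (4 * a ^ 2))) := by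
        ring
    _ = _ := by
        rw [s₂, s₁, s₀, r₁]
        have hq : √(4 * a ^ 2 - 1) ≠ 0 := (sqrt_pos.mpr hγ).ne'
        have hγ' := hγ.ne'
        generalize √(4 * a ^ 2 - 1) = q at *
        generalize √(a * (a - 1 / a)) = w at *
        generalize hg : 4 * a ^ 2 - 1 = g at *
        field_simp
        ring
end

section
/- Fix n ≥ 2 and real numbers y₁,…,yₙ with ∑_{i=1}^n yᵢ = 0 and ∑_{i=1}^n yᵢ² = n, and set b₁ = (1/n)∑_{i=1}^n yᵢ³ and b₂ = (1/n)∑_{i=1}^n yᵢ⁴. Then, as β → ∞, ∑_{i=1}^n ∑_{j=1}^n exp( (yᵢ+yⱼ)²/(4β) ) = n² + n²/(2β) + n²b₂/(16β²) + 3n²/(16β²) + (n/(192β³))∑_{i=1}^n yᵢ⁶ + 5n²b₂/(64β³) + 5n²b₁²/(96β³) + O(β^{-4}). -/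
open MeasureTheory Filter Real Asymptotics

/-- Binomial expansion of a double sum of powers in terms of power sums. -/
theorem sum_sum_add_pow {ι R : Type*} [Fintype ι] [CommSemiring R] (y : ι → R) (k : ℕ) :
    ∑ i, ∑ j, (y i + y j) ^ k =
      ∑ m ∈ Finset.range (k + 1), (∑ i, y i ^ m) * (∑ j, y j ^ (k - m)) * (k.choose m : R) := by
  simp_rw [add_pow, Finset.sum_mul_sum, Finset.sum_mul]
  rw [Finset.sum_comm (s := Finset.range (k + 1))]
  exact Finset.sum_congr rfl fun i _ => Finset.sum_comm

/-- Taylor expansion at infinity of `β ↦ exp (c / β)`. -/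
theorem exp_div_sub_sum_range_isBigO_atTop (c : ℝ) (k : ℕ) :
    (fun β : ℝ => Real.exp (c / β) - ∑ m ∈ Finset.range k, (c / β) ^ m / m.factorial)
      =O[atTop] fun β : ℝ => β ^ (-k : ℤ) := by
  have hc : Tendsto (fun β : ℝ => c / β) atTop (nhds 0) := tendsto_const_nhds.div_atTop tendsto_id
  refine ((Real.exp_sub_sum_range_isBigO_pow k).comp_tendsto hc).trans ?_
  refine IsBigO.of_bound (|c| ^ k) (Eventually.of_forall fun β => ?_)
  simp [div_eq_mul_inv, mul_pow]

/-- Asymptotic expansion, as `β → ∞`, of the double sum in the closed-form representation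
of `T_{n,β}`, where `b₁ = (1/n)∑ yᵢ³` and `b₂ = (1/n)∑ yᵢ⁴`. -/
theorem double_sum_expansion (n : ℕ) (hn : 2 ≤ n) (y : Fin n → ℝ)
    (h1 : ∑ i, y i = 0) (h2 : ∑ i, (y i) ^ 2 = n) :
    (fun β : ℝ =>
        (∑ i, ∑ j, Real.exp ((y i + y j) ^ 2 / (4 * β)))
          - ((n : ℝ) ^ 2 + (n : ℝ) ^ 2 / (2 * β)
              + (n : ℝ) ^ 2 * ((1 / n : ℝ) * ∑ i, (y i) ^ 4) / (16 * β ^ 2)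
              + 3 * (n : ℝ) ^ 2 / (16 * β ^ 2)
              + ((n : ℝ) / (192 * β ^ 3)) * ∑ i, (y i) ^ 6
              + 5 * (n : ℝ) ^ 2 * ((1 / n : ℝ) * ∑ i, (y i) ^ 4) / (64 * β ^ 3)
              + 5 * (n : ℝ) ^ 2 * ((1 / n : ℝ) * ∑ i, (y i) ^ 3) ^ 2 / (96 * β ^ 3)))
      =O[atTop] fun β : ℝ => β ^ (-4 : ℤ) := by
  have hn0 : (n : ℝ) ≠ 0 := by positivity
  have hpow2 : ∑ i, ∑ j, (y i + y j) ^ 2 = 2 * (n : ℝ) ^ 2 := by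
    rw [sum_sum_add_pow]
    simp [Finset.sum_range_succ, h1, h2]
    ring
  have hpow4 : ∑ i, ∑ j, (y i + y j) ^ 4 = 2 * n * ∑ i, y i ^ 4 + 6 * (n : ℝ) ^ 2 := by
    rw [sum_sum_add_pow]
    simp [Finset.sum_range_succ, h1, h2, Nat.choose]
    ring
  have hpow6 : ∑ i, ∑ j, (y i + y j) ^ 6 =
      2 * n * ∑ i, y i ^ 6 + 30 * n * ∑ i, y i ^ 4 + 20 * (∑ i, y i ^ 3) ^ 2 := by
    rw [sum_sum_add_pow]
    simp [Finset.sum_range_succ, h1, h2, Nat.choose]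
    ring
  have hO : (fun β : ℝ => ∑ i, ∑ j, (Real.exp ((y i + y j) ^ 2 / 4 / β)
      - ∑ m ∈ Finset.range 4, ((y i + y j) ^ 2 / 4 / β) ^ m / m.factorial))
      =O[atTop] fun β : ℝ => β ^ (-4 : ℤ) :=
    IsBigO.fun_sum fun i _ => IsBigO.fun_sum fun j _ => exp_div_sub_sum_range_isBigO_atTop _ 4
  refine hO.congr' ?_ EventuallyEq.rfl
  filter_upwards [eventually_gt_atTop 0] with β hβ
  have hterm (i j : Fin n) : ∑ m ∈ Finset.range 4, ((y i + y j) ^ 2 / 4 / β) ^ m / m.factorial =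
      1 + (y i + y j) ^ 2 * (1 / (4 * β)) + (y i + y j) ^ 4 * (1 / (32 * β ^ 2))
        + (y i + y j) ^ 6 * (1 / (384 * β ^ 3)) := by
    simp only [Finset.sum_range_succ, Finset.sum_range_zero, Nat.factorial]
    push_cast
    field_simp
    ring
  simp only [Finset.sum_sub_distrib, hterm, Finset.sum_add_distrib, ← Finset.sum_mul, hpow2, hpow4,
    hpow6]
  simp only [div_div]
  congr 1
  simp only [Finset.sum_const, Finset.card_univ, Fintype.card_fin, nsmul_eq_mul]
  field_simp
  ring
end

section
/- Let β > 1, μ ∈ ℝ, σ > 0, and define g(x,t) = exp( t(x−μ)/σ ) − exp(t²/2) and h_β(x,y) = √π·( 1/√(β−1) − (1/√(β−1/2))·( exp( (x−μ)²/((4β−2)σ²) ) + exp( (y−μ)²/((4β−2)σ²) ) ) + (1/√β)·exp( (x+y−2μ)²/(4βσ²) ) ). Then for all x, y ∈ ℝ, h_β(x,y) = ∫_{-∞}^{∞} g(x,t)·g(y,t)·exp(−β t²) dt. -/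
open MeasureTheory Real

theorem exp_neg_mul_sq_add_mul_eq {b : ℝ} (hb : b ≠ 0) (c t : ℝ) :
    Real.exp (-b * t ^ 2 + c * t)
      = Real.exp (c ^ 2 / (4 * b)) * Real.exp (-b * (t - c / (2 * b)) ^ 2) := by
  rw [← Real.exp_add]
  congr 1
  field

theorem integrable_exp_neg_mul_sq_add_mul {b : ℝ} (hb : 0 < b) (c : ℝ) :
    Integrable fun t : ℝ => Real.exp (-b * t ^ 2 + c * t) := by
  simp_rw [exp_neg_mul_sq_add_mul_eq hb.ne']
  exact ((integrable_exp_neg_mul_sq hb).comp_sub_right _).const_mul _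

theorem integral_exp_neg_mul_sq_add_mul {b : ℝ} (hb : 0 < b) (c : ℝ) :
    ∫ t : ℝ, Real.exp (-b * t ^ 2 + c * t)
      = Real.sqrt π * (1 / Real.sqrt b * Real.exp (c ^ 2 / (4 * b))) := by
  simp_rw [exp_neg_mul_sq_add_mul_eq hb.ne']
  rw [integral_const_mul,
    integral_sub_right_eq_self (fun t : ℝ => Real.exp (-b * t ^ 2)) (c / (2 * b)),
    integral_gaussian, Real.sqrt_div' _ hb.le]
  ring

/-- The V-statistic kernel identity: `h_β(x,y) = ∫ g(x,t)g(y,t)e^{−βt²} dt` where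
`g(x,t) = e^{t(x−μ)/σ} − e^{t²/2}`. -/
theorem kernel_eq_integral (β : ℝ) (hβ : 1 < β) (μ σ : ℝ) (hσ : 0 < σ) (x y : ℝ) :
    Real.sqrt π *
        (1 / Real.sqrt (β - 1)
          - 1 / Real.sqrt (β - 1 / 2)
              * (Real.exp ((x - μ) ^ 2 / ((4 * β - 2) * σ ^ 2))
                  + Real.exp ((y - μ) ^ 2 / ((4 * β - 2) * σ ^ 2)))
          + 1 / Real.sqrt β * Real.exp ((x + y - 2 * μ) ^ 2 / (4 * β * σ ^ 2)))
      = ∫ t : ℝ,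
          (Real.exp (t * (x - μ) / σ) - Real.exp (t ^ 2 / 2))
            * (Real.exp (t * (y - μ) / σ) - Real.exp (t ^ 2 / 2))
            * Real.exp (-β * t ^ 2) := by
  have hβ₁ : 0 < β - 1 := by linarith
  have hβ₂ : 0 < β - 1 / 2 := by linarith
  have hβ₀ : 0 < β := by linarith
  have hsplit : ∀ t : ℝ,
      (Real.exp (t * (x - μ) / σ) - Real.exp (t ^ 2 / 2))
          * (Real.exp (t * (y - μ) / σ) - Real.exp (t ^ 2 / 2)) * Real.exp (-β * t ^ 2)
        = Real.exp (-(β - 1) * t ^ 2 + 0 * t)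
          - (Real.exp (-(β - 1 / 2) * t ^ 2 + (x - μ) / σ * t)
            + Real.exp (-(β - 1 / 2) * t ^ 2 + (y - μ) / σ * t))
          + Real.exp (-β * t ^ 2 + (x + y - 2 * μ) / σ * t) := by
    intro t
    have h₁ : Real.exp (-(β - 1) * t ^ 2 + 0 * t)
        = Real.exp (t ^ 2 / 2) * Real.exp (t ^ 2 / 2) * Real.exp (-β * t ^ 2) := by
      rw [← Real.exp_add, ← Real.exp_add]
      ring_nf
    have h₂ : ∀ z : ℝ, Real.exp (-(β - 1 / 2) * t ^ 2 + (z - μ) / σ * t)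
        = Real.exp (t * (z - μ) / σ) * Real.exp (t ^ 2 / 2) * Real.exp (-β * t ^ 2) := by
      intro z
      rw [← Real.exp_add, ← Real.exp_add]
      ring_nf
    have h₃ : Real.exp (-β * t ^ 2 + (x + y - 2 * μ) / σ * t)
        = Real.exp (t * (x - μ) / σ) * Real.exp (t * (y - μ) / σ) * Real.exp (-β * t ^ 2) := by
      rw [← Real.exp_add, ← Real.exp_add]
      ring_nf
    rw [h₁, h₂, h₂, h₃]
    ring
  have hi₁ := integrable_exp_neg_mul_sq_add_mul hβ₁ 0
  have hi₂ := fun z : ℝ => integrable_exp_neg_mul_sq_add_mul hβ₂ ((z - μ) / σ)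
  have hi₃ := integrable_exp_neg_mul_sq_add_mul hβ₀ ((x + y - 2 * μ) / σ)
  have harg : ∀ z : ℝ,
      ((z - μ) / σ) ^ 2 / (4 * (β - 1 / 2)) = (z - μ) ^ 2 / ((4 * β - 2) * σ ^ 2) := by
    intro z
    rw [div_pow, div_div]
    ring_nf
  have harg' : ((x + y - 2 * μ) / σ) ^ 2 / (4 * β)
      = (x + y - 2 * μ) ^ 2 / (4 * β * σ ^ 2) := by
    rw [div_pow, div_div, mul_comm (σ ^ 2)]
  simp_rw [hsplit]
  rw [integral_add (by exact hi₁.sub ((hi₂ x).add (hi₂ y))) hi₃,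
    integral_sub hi₁ (by exact (hi₂ x).add (hi₂ y)), integral_add (hi₂ x) (hi₂ y),
    integral_exp_neg_mul_sq_add_mul hβ₁, integral_exp_neg_mul_sq_add_mul hβ₂,
    integral_exp_neg_mul_sq_add_mul hβ₂, integral_exp_neg_mul_sq_add_mul hβ₀,
    harg, harg, harg', zero_pow two_ne_zero, zero_div, Real.exp_zero]
  ring
end

section
/- Let β > 1, n ≥ 2, and let x₁,…,xₙ be real numbers that are not all equal. Put X̄ = (1/n)∑xⱼ, S² = (1/n)∑(xⱼ−X̄)², Y_j = (xⱼ−X̄)/S, Mₙ(t) = (1/n)∑exp(t·Yⱼ), and T_{n,β} = n∫(Mₙ(t)−e^{t²/2})² e^{−βt²}dt. With h_β(x,y;μ,σ²) = √π( 1/√(β−1) − (1/√(β−1/2))( exp((x−μ)²/((4β−2)σ²)) + exp((y−μ)²/((4β−2)σ²)) ) + (1/√β)exp((x+y−2μ)²/(4βσ²)) ), we have T_{n,β}/n = (1/n²)∑_{i=1}^n ∑_{j=1}^n h_β(xᵢ, xⱼ; X̄, S²). -/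
open MeasureTheory Real

lemma exp_quadratic_eq_mul_exp_shift {b : ℝ} (hb : 0 < b) (c t : ℝ) :
    exp (-b * t ^ 2 + c * t) = exp (c ^ 2 / (4 * b)) * exp (-b * (t - c / (2 * b)) ^ 2) := by
  rw [← exp_add]
  congr 1
  field_simp
  ring

lemma integrable_exp_quadratic {b : ℝ} (hb : 0 < b) (c : ℝ) :
    Integrable fun t : ℝ => exp (-b * t ^ 2 + c * t) := by
  simp_rw [exp_quadratic_eq_mul_exp_shift hb c]
  exact ((integrable_exp_neg_mul_sq hb).comp_sub_right (c / (2 * b))).const_mul _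

lemma integral_exp_quadratic {b : ℝ} (hb : 0 < b) (c : ℝ) :
    ∫ t : ℝ, exp (-b * t ^ 2 + c * t) = √π / √b * exp (c ^ 2 / (4 * b)) := by
  simp_rw [exp_quadratic_eq_mul_exp_shift hb c]
  rw [integral_const_mul, integral_sub_right_eq_self (fun t : ℝ => exp (-b * t ^ 2)),
    integral_gaussian, sqrt_div pi_pos.le, mul_comm]

/-- The expanded product of two centred exponentials, weighted by a Gaussian. -/
lemma exp_sub_mul_exp_sub_mul_gaussian (β a b t : ℝ) :
    (exp (t * a) - exp (t ^ 2 / 2)) * (exp (t * b) - exp (t ^ 2 / 2)) * exp (-β * t ^ 2) =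
      exp (-(β - 1) * t ^ 2 + 0 * t) - (exp (-(β - 1 / 2) * t ^ 2 + a * t)
        + exp (-(β - 1 / 2) * t ^ 2 + b * t)) + exp (-β * t ^ 2 + (a + b) * t) := by
  have h₁ : exp (-(β - 1) * t ^ 2 + 0 * t) =
      exp (t ^ 2 / 2) * exp (t ^ 2 / 2) * exp (-β * t ^ 2) := by
    simp only [← exp_add]; ring_nf
  have h₂ (c : ℝ) : exp (-(β - 1 / 2) * t ^ 2 + c * t) =
      exp (t * c) * exp (t ^ 2 / 2) * exp (-β * t ^ 2) := by
    simp only [← exp_add]; ring_nf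
  have h₃ : exp (-β * t ^ 2 + (a + b) * t) = exp (t * a) * exp (t * b) * exp (-β * t ^ 2) := by
    simp only [← exp_add]; ring_nf
  rw [h₁, h₂, h₂, h₃]
  ring

lemma integrable_exp_sub_mul_exp_sub_mul_gaussian {β : ℝ} (hβ : 1 < β) (a b : ℝ) :
    Integrable fun t : ℝ =>
      (exp (t * a) - exp (t ^ 2 / 2)) * (exp (t * b) - exp (t ^ 2 / 2)) * exp (-β * t ^ 2) := by
  simp_rw [exp_sub_mul_exp_sub_mul_gaussian]
  have hhalf : 0 < β - 1 / 2 := by linarith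
  exact ((integrable_exp_quadratic (by linarith) 0).sub
    ((integrable_exp_quadratic hhalf a).add (integrable_exp_quadratic hhalf b))).add
    (integrable_exp_quadratic (by linarith) (a + b))

lemma integral_exp_sub_mul_exp_sub_mul_gaussian {β : ℝ} (hβ : 1 < β) (a b : ℝ) :
    ∫ t : ℝ,
      (exp (t * a) - exp (t ^ 2 / 2)) * (exp (t * b) - exp (t ^ 2 / 2)) * exp (-β * t ^ 2) =
    √π * (1 / √(β - 1)
      - 1 / √(β - 1 / 2) * (exp (a ^ 2 / (4 * β - 2)) + exp (b ^ 2 / (4 * β - 2)))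
      + 1 / √β * exp ((a + b) ^ 2 / (4 * β))) := by
  simp_rw [exp_sub_mul_exp_sub_mul_gaussian]
  have hone : 0 < β - 1 := by linarith
  have hhalf : 0 < β - 1 / 2 := by linarith
  have hpos : 0 < β := by linarith
  have i₁ := integrable_exp_quadratic hone 0
  have ia := integrable_exp_quadratic hhalf a
  have ib := integrable_exp_quadratic hhalf b
  rw [integral_add (by exact i₁.sub (ia.add ib)) (integrable_exp_quadratic hpos (a + b)),
    integral_sub i₁ (by exact ia.add ib), integral_add ia ib]
  simp only [integral_exp_quadratic, hone, hhalf, hpos]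
  rw [show 4 * (β - 1 / 2) = 4 * β - 2 by ring]
  simp only [ne_eq, OfNat.ofNat_ne_zero, not_false_eq_true, zero_pow, zero_div, exp_zero]
  ring

lemma mean_sub_sq_eq_sum_sum {n : ℕ} (hn : n ≠ 0) (a : Fin n → ℝ) (e : ℝ) :
    ((1 / n : ℝ) * ∑ j, a j - e) ^ 2 =
      (1 / (n : ℝ) ^ 2) * ∑ i, ∑ j, (a i - e) * (a j - e) := by
  have hn' : (n : ℝ) ≠ 0 := Nat.cast_ne_zero.mpr hn
  rw [← Finset.sum_mul_sum, Finset.sum_sub_distrib, Finset.sum_const, Finset.card_univ,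
    Fintype.card_fin, nsmul_eq_mul]
  field_simp

/-- V-statistic representation of `T_{n,β}/n` with estimated parameters `(X̄, S²)`. -/
theorem Tnbeta_div_n_eq_Vstatistic (β : ℝ) (hβ : 1 < β) (n : ℕ) (hn : 2 ≤ n)
    (x : Fin n → ℝ) (hx : ∃ i j, x i ≠ x j) :
    let m : ℝ := (1 / n : ℝ) * ∑ j, x j
    let S : ℝ := Real.sqrt ((1 / n : ℝ) * ∑ j, (x j - m) ^ 2)
    ((n : ℝ) * ∫ t : ℝ,
        ((1 / n : ℝ) * ∑ j, Real.exp (t * ((x j - m) / S)) - Real.exp (t ^ 2 / 2)) ^ 2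
          * Real.exp (-β * t ^ 2)) / n
      = (1 / (n : ℝ) ^ 2) * ∑ i, ∑ j,
          Real.sqrt π *
            (1 / Real.sqrt (β - 1)
              - 1 / Real.sqrt (β - 1 / 2)
                  * (Real.exp ((x i - m) ^ 2 / ((4 * β - 2) * S ^ 2))
                      + Real.exp ((x j - m) ^ 2 / ((4 * β - 2) * S ^ 2)))
              + 1 / Real.sqrt β * Real.exp ((x i + x j - 2 * m) ^ 2 / (4 * β * S ^ 2))) := by
  intro m S
  have hn₀ : n ≠ 0 := by lia
  rw [mul_div_cancel_left₀ _ (Nat.cast_ne_zero.mpr hn₀ : (n : ℝ) ≠ 0)]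
  simp_rw [mean_sub_sq_eq_sum_sum hn₀, mul_assoc (1 / (n : ℝ) ^ 2), Finset.sum_mul]
  rw [integral_const_mul, integral_finsetSum _ fun i _ => integrable_finsetSum _ fun j _ =>
    integrable_exp_sub_mul_exp_sub_mul_gaussian hβ _ _]
  congr 1
  refine Finset.sum_congr rfl fun i _ => ?_
  rw [integral_finsetSum _ fun j _ => integrable_exp_sub_mul_exp_sub_mul_gaussian hβ _ _]
  refine Finset.sum_congr rfl fun j _ => ?_
  have hdiv (u c : ℝ) : (u / S) ^ 2 / c = u ^ 2 / (c * S ^ 2) := by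
    rw [div_pow, div_div, mul_comm]
  rw [integral_exp_sub_mul_exp_sub_mul_gaussian hβ, ← add_div, hdiv, hdiv, hdiv,
    show x i - m + (x j - m) = x i + x j - 2 * m by ring]
end
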